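/- Let I ⊆ (0,∞) and J ⊆ ℝ be nonempty open intervals, let β(s) = (1, s, s), let γ(s) = (x(s), y(s), z(s)) be smooth on I with ⟨γ'(s), β(s)⟩ = 0 for all s ∈ I, and let V = (v₁, v₂, v₃) ∈ ℝ³. Suppose that for every s ∈ I and every t ∈ J the ruled surface X(s,t) = γ(s) + t·β(s) is nondegenerate (EG − F² ≠ 0) and satisfies the translating soliton equation (★). Then y'(s) ≠ z'(s) for every s ∈ I, v₂ ≠ v₃, and the ordinary differential equation (v₂ − v₃)·(y''(s) − z''(s)) − 8·(y'(s) − z'(s))² = 0 holds for all s ∈ I. -/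

import Mathlib

noncomputable section

open Real

/-- The Lorentzian inner product on `𝕃³ = ℝ³`: `⟨x,y⟩ = x₁y₁ + x₂y₂ − x₃y₃`. -/
def Lprod (u v : Fin 3 → ℝ) : ℝ := u 0 * v 0 + u 1 * v 1 - u 2 * v 2

/-- The mixed product `(u,v,w) = det(u,v,w)`. -/
def mixed (u v w : Fin 3 → ℝ) : ℝ :=
  u 0 * (v 1 * w 2 - v 2 * w 1) - u 1 * (v 0 * w 2 - v 2 * w 0) +
    u 2 * (v 0 * w 1 - v 1 * w 0)

/-- `X_s = γ' + t β'` for the ruled surface `X(s,t) = γ(s) + t β(s)`. -/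
def Xs (γ β : ℝ → Fin 3 → ℝ) (s t : ℝ) : Fin 3 → ℝ := deriv γ s + t • deriv β s

/-- `X_ss = γ'' + t β''`. -/
def Xss (γ β : ℝ → Fin 3 → ℝ) (s t : ℝ) : Fin 3 → ℝ :=
  deriv (deriv γ) s + t • deriv (deriv β) s

/-- Nondegeneracy at `(s,t)`: `EG − F² ≠ 0`. -/
def Nondeg (γ β : ℝ → Fin 3 → ℝ) (s t : ℝ) : Prop :=
  Lprod (Xs γ β s t) (Xs γ β s t) * Lprod (β s) (β s) -
      (Lprod (Xs γ β s t) (β s)) ^ 2 ≠ 0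

/-- The translating soliton equation (★) of the IMCF at `(s,t)`:
`(X_s,X_t,V)·[G·(X_s,X_t,X_ss) − 2F·(X_s,X_t,X_st)] = 2(EG − F²)²`,
where `X_t = β` and `X_st = β'`. -/
def SolitonEq (γ β : ℝ → Fin 3 → ℝ) (V : Fin 3 → ℝ) (s t : ℝ) : Prop :=
  mixed (Xs γ β s t) (β s) V *
      (Lprod (β s) (β s) * mixed (Xs γ β s t) (β s) (Xss γ β s t) -
        2 * Lprod (Xs γ β s t) (β s) * mixed (Xs γ β s t) (β s) (deriv β s)) =
    2 * (Lprod (Xs γ β s t) (Xs γ β s t) * Lprod (β s) (β s) -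
          (Lprod (Xs γ β s t) (β s)) ^ 2) ^ 2

/-- A curve given by three coordinate functions is differentiated coordinatewise. -/
theorem deriv_vec3 {f g h : ℝ → ℝ} {s : ℝ} (hf : DifferentiableAt ℝ f s)
    (hg : DifferentiableAt ℝ g s) (hh : DifferentiableAt ℝ h s) :
    deriv (fun r => ![f r, g r, h r]) s = ![deriv f s, deriv g s, deriv h s] := by
  refine HasDerivAt.deriv (hasDerivAt_pi.2 fun i => ?_)
  fin_cases i
  · exact hf.hasDerivAt
  · exact hg.hasDerivAt
  · exact hh.hasDerivAt

/-- An open set containing `t` contains a symmetric pair `t ± h` with `h ≠ 0`. -/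
theorem exists_symm_mem_of_isOpen {J : Set ℝ} (hJ : IsOpen J) {t : ℝ} (ht : t ∈ J) :
    ∃ h : ℝ, h ≠ 0 ∧ t + h ∈ J ∧ t - h ∈ J := by
  obtain ⟨ε, hε, hball⟩ := Metric.isOpen_iff.1 hJ t ht
  have habs : |ε / 2| < ε := by rw [abs_of_pos (half_pos hε)]; exact half_lt_self hε
  refine ⟨ε / 2, (half_pos hε).ne', hball ?_, hball ?_⟩ <;>
    simpa [Real.dist_eq, abs_div] using habs

/-- With `γ' = (a, b, c)`, `γ'' = (a', b', c')`, `β = (1, s, s)` and `γ' ⊥ β`, the soliton equation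
is quadratic in `t`; if it holds on an open set of `t`, its leading coefficient vanishes. -/
theorem leading_coeff_eq_zero {J : Set ℝ} (hJopen : IsOpen J) (hJne : J.Nonempty)
    {γ β : ℝ → Fin 3 → ℝ} {s a b c a' b' c' v₁ v₂ v₃ : ℝ}
    (hβ : β s = ![1, s, s]) (hβ' : deriv β s = ![0, 1, 1]) (hβ'' : deriv (deriv β) s = 0)
    (hγ' : deriv γ s = ![a, b, c]) (hγ'' : deriv (deriv γ) s = ![a', b', c'])
    (horth : a + s * (b - c) = 0)
    (hsol : ∀ t ∈ J, SolitonEq γ β ![v₁, v₂, v₃] s t) :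
    (v₂ - v₃) * (b' - c') - 8 * (b - c) ^ 2 = 0 := by
  obtain ⟨t, ht⟩ := hJne
  obtain ⟨h, hh, hp, hm⟩ := exists_symm_mem_of_isOpen hJopen ht
  have e₀ := hsol _ ht
  have e₁ := hsol _ hp
  have e₂ := hsol _ hm
  obtain rfl : a = -(s * (b - c)) := by linarith
  simp only [SolitonEq, Xs, Xss, hβ, hβ', hβ'', hγ', hγ'', Lprod, mixed, Pi.add_apply,
    Pi.smul_apply, Pi.zero_apply, smul_eq_mul, Matrix.cons_val] at e₀ e₁ e₂
  refine (mul_eq_zero.1 (?_ : 2 * h ^ 2 * _ = 0)).resolve_left (by positivity)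
  linear_combination e₁ + e₂ - 2 * e₀

/-- for a non-cylindrical ruled IMCF translating soliton with director
`β(s) = (1,s,s)`, one has `y' ≠ z'`, `v₂ ≠ v₃`, and the ODE
`(v₂ − v₃)(y'' − z'') − 8(y' − z')² = 0`. -/
theorem noncylindrical_base_curve_ode
    (I J : Set ℝ) (hIopen : IsOpen I) (hIne : I.Nonempty) (hIconn : I.OrdConnected)
    (hIpos : I ⊆ Set.Ioi (0 : ℝ))
    (hJopen : IsOpen J) (hJne : J.Nonempty) (hJconn : J.OrdConnected)
    (x y z : ℝ → ℝ) (hx : ContDiffOn ℝ (⊤ : ℕ∞) x I) (hy : ContDiffOn ℝ (⊤ : ℕ∞) y I)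
    (hz : ContDiffOn ℝ (⊤ : ℕ∞) z I)
    (γ β : ℝ → Fin 3 → ℝ)
    (hγdef : ∀ s, γ s = ![x s, y s, z s]) (hβdef : ∀ s, β s = ![1, s, s])
    (horth : ∀ s ∈ I, Lprod (deriv γ s) (β s) = 0)
    (v₁ v₂ v₃ : ℝ) (V : Fin 3 → ℝ) (hV : V = ![v₁, v₂, v₃])
    (hnd : ∀ s ∈ I, ∀ t ∈ J, Nondeg γ β s t)
    (hsol : ∀ s ∈ I, ∀ t ∈ J, SolitonEq γ β V s t) :
    (∀ s ∈ I, deriv y s ≠ deriv z s) ∧ v₂ ≠ v₃ ∧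
      ∀ s ∈ I, (v₂ - v₃) * (deriv (deriv y) s - deriv (deriv z) s) -
        8 * (deriv y s - deriv z s) ^ 2 = 0 := by
  have hβ : β = fun r => ![1, r, r] := funext hβdef
  have hγ : γ = fun r => ![x r, y r, z r] := funext hγdef
  have hβ' : deriv β = fun _ => ![0, 1, 1] := by
    funext r
    rw [hβ, deriv_vec3 (f := fun _ => 1) (g := fun r => r) (h := fun r => r)
      (by fun_prop) (by fun_prop) (by fun_prop)]
    simp
  have hβ'' (s : ℝ) : deriv (deriv β) s = 0 := by rw [hβ', deriv_const]
  have diff {f : ℝ → ℝ} (hf : ContDiffOn ℝ (⊤ : ℕ∞) f I) {s : ℝ} (hs : s ∈ I) :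
      DifferentiableAt ℝ f s :=
    (hf.contDiffAt (hIopen.mem_nhds hs)).differentiableAt (by simp)
  have contDiffOn_deriv {f : ℝ → ℝ} (hf : ContDiffOn ℝ (⊤ : ℕ∞) f I) :
      ContDiffOn ℝ (⊤ : ℕ∞) (deriv f) I := hf.deriv_of_isOpen hIopen (by simp)
  have hγ' {s : ℝ} (hs : s ∈ I) : deriv γ s = ![deriv x s, deriv y s, deriv z s] := by
    rw [hγ, deriv_vec3 (diff hx hs) (diff hy hs) (diff hz hs)]
  have hγ'' {s : ℝ} (hs : s ∈ I) : deriv (deriv γ) s =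
      ![deriv (deriv x) s, deriv (deriv y) s, deriv (deriv z) s] := by
    have heq : deriv γ =ᶠ[nhds s] fun r => ![deriv x r, deriv y r, deriv z r] :=
      Filter.eventually_of_mem (hIopen.mem_nhds hs) fun r hr => hγ' hr
    rw [heq.deriv_eq, deriv_vec3 (diff (contDiffOn_deriv hx) hs)
      (diff (contDiffOn_deriv hy) hs) (diff (contDiffOn_deriv hz) hs)]
  have horth' {s : ℝ} (hs : s ∈ I) : deriv x s + s * (deriv y s - deriv z s) = 0 := by
    have h := horth s hs
    simp only [Lprod, hγ' hs, hβdef s, Matrix.cons_val] at h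
    linear_combination h
  have hne : ∀ s ∈ I, deriv y s ≠ deriv z s := by
    intro s hs hyz
    obtain ⟨t, ht⟩ := hJne
    have ha : deriv x s = 0 := by simpa [hyz] using horth' hs
    apply hnd s hs t ht
    simp only [Lprod, Xs, hγ' hs, hβdef s, hβ', ha, hyz, Pi.add_apply, Pi.smul_apply,
      smul_eq_mul, Matrix.cons_val]
    ring
  have hode : ∀ s ∈ I, (v₂ - v₃) * (deriv (deriv y) s - deriv (deriv z) s) -
      8 * (deriv y s - deriv z s) ^ 2 = 0 := fun s hs =>
    leading_coeff_eq_zero hJopen hJne (hβdef s) (congrFun hβ' s) (hβ'' s) (hγ' hs) (hγ'' hs)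
      (horth' hs) fun t ht => hV ▸ hsol s hs t ht
  refine ⟨hne, ?_, hode⟩
  rintro rfl
  obtain ⟨s, hs⟩ := hIne
  have h := hode s hs
  simp only [sub_self, zero_mul, zero_sub, neg_eq_zero, mul_eq_zero, OfNat.ofNat_ne_zero,
    false_or, pow_eq_zero_iff, ne_eq, not_false_eq_true] at h
  exact hne s hs (sub_eq_zero.1 h)
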